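/- Let $d \geq 1$ and let $I$ be any strictly increasing sequence $i_1 < i_2 < \cdots$ of positive integers. Then the $T$-space $R_{\infty,I}^{(d)}$ generated by $\{S_{i_j}^{(d)} : j \geq 1\}$ is finitely based, with a $T$-space basis of size at most $i_2 - i_1 + 1$. -/

import Mathlib

open scoped BigOperators

/-- The free non-unital associative algebra over `k` on countably many variables,
realized as the semigroup algebra of the free semigroup on `ℕ`. -/
abbrev FA (k : Type*) [Field k] := MonoidAlgebra k (FreeSemigroup ℕ)

/-- The generator (variable) `x_i`. -/
noncomputable def Xg (k : Type*) [Field k] (i : ℕ) : FA k :=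
  MonoidAlgebra.single (FreeSemigroup.of i) 1

/-- Product of a (nonempty) list in a non-unital semiring; `0` on the empty list. -/
def lprod {A : Type*} [NonUnitalSemiring A] : List A → A
  | [] => 0
  | [a] => a
  | a :: b :: l => a * lprod (b :: l)

/-- `n`-th power in a non-unital semiring (zero for `n = 0`). -/
def npow' {A : Type*} [NonUnitalSemiring A] (a : A) (n : ℕ) : A :=
  lprod (List.replicate n a)

/-- The full multilinear symmetrization `S^{(d)}(y_1,…,y_d) = ∑_{σ ∈ Σ_d} y_{σ(1)} ⋯ y_{σ(d)}`. -/
def Ssym {A : Type*} [NonUnitalSemiring A] (d : ℕ) (y : Fin d → A) : A :=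
  ∑ σ : Equiv.Perm (Fin d), lprod (List.ofFn (fun i => y (σ i)))

/-- A T-space: a subspace closed under all substitution endomorphisms
(non-unital algebra endomorphisms). -/
def IsTSpace (k : Type*) [Field k] (V : Submodule k (FA k)) : Prop :=
  ∀ (φ : FA k →ₙₐ[k] FA k), ∀ v ∈ V, φ v ∈ V

/-- The T-space generated by a set `S`: the span of all substitution instances
of elements of `S`. -/
noncomputable def TSpan (k : Type*) [Field k] (S : Set (FA k)) : Submodule k (FA k) :=
  Submodule.span k {a | ∃ (φ : FA k →ₙₐ[k] FA k) (s : FA k), s ∈ S ∧ a = φ s}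

/-- The set of products `u * v` with `u ∈ U`, `v ∈ V`. -/
def mulSet {k : Type*} [Field k] (U V : Submodule k (FA k)) : Set (FA k) :=
  {a | ∃ u ∈ U, ∃ v ∈ V, a = u * v}

/-- The T-spaces `S_n^{(d)}`: `S_1^{(d)}` is generated by `S^{(d)}(x_1,…,x_d)` and
`S_{n+1}^{(d)} = (S_n^{(d)} S_1^{(d)})^S`. -/
noncomputable def Sn (k : Type*) [Field k] (d : ℕ) : ℕ → Submodule k (FA k)
  | 0 => ⊥
  | 1 => TSpan k {Ssym d (fun i => Xg k i)}
  | (n+2) => TSpan k (mulSet (Sn k d (n+1)) (Sn k d 1))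

/-- The T-spaces `H_n`: `H_1` is generated by `x_1^p` and `H_{n+1} = (H_n H_1)^S`. -/
noncomputable def Hn (k : Type*) [Field k] (p : ℕ) : ℕ → Submodule k (FA k)
  | 0 => ⊥
  | 1 => TSpan k {npow' (Xg k 0) p}
  | (n+2) => TSpan k (mulSet (Hn k p (n+1)) (Hn k p 1))

/-- The word `x_1^p x_2^p ⋯ x_n^p`. -/
noncomputable def hword (k : Type*) [Field k] (p n : ℕ) : FA k :=
  lprod ((List.range n).map (fun t => npow' (Xg k t) p))

section Words

variable {A : Type*}

theorem lprod_cons [NonUnitalSemiring A] (a : A) {l : List A} (hl : l ≠ []) :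
    lprod (a :: l) = a * lprod l := by
  cases l with
  | nil => exact absurd rfl hl
  | cons b l => rfl

theorem lprod_ofFn_cons [NonUnitalSemiring A] {n : ℕ} (a : A) (w : Fin (n + 1) → A) :
    lprod (List.ofFn (Fin.cons a w : Fin (n + 2) → A)) = a * lprod (List.ofFn w) := by
  rw [List.ofFn_cons, lprod_cons]
  simp

theorem map_lprod [NonUnitalSemiring A] {B F : Type*} [NonUnitalSemiring B] [FunLike F A B]
    [NonUnitalRingHomClass F A B] (f : F) : ∀ l : List A, f (lprod l) = lprod (l.map f)
  | [] => by simp [lprod]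
  | [a] => rfl
  | a :: b :: l => by simpa [lprod] using congrArg (f a * ·) (map_lprod f (b :: l))

theorem insertNth_succ_cons {n : ℕ} (j : Fin (n + 1)) (u a : A) (w : Fin n → A) :
    (Fin.insertNth j.succ u (Fin.cons a w : Fin (n + 1) → A) : Fin (n + 2) → A) =
      Fin.cons a (Fin.insertNth j u w : Fin (n + 1) → A) := by
  ext i
  induction i using Fin.succAboveCases j.succ with
  | x => simp
  | p i =>
    cases i using Fin.cases with
    | zero => simp
    | succ i => simp

theorem lprod_insertNth_castSucc [NonUnitalSemiring A] {n : ℕ} (j : Fin n) (u : A)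
    (w : Fin n → A) :
    lprod (List.ofFn (Fin.insertNth j.castSucc u w : Fin (n + 1) → A)) =
      lprod (List.ofFn (Function.update w j (u * w j))) := by
  induction n with
  | zero => exact j.elim0
  | succ n ih =>
    induction w using Fin.consCases with
    | _ a w =>
    cases j using Fin.cases with
    | zero =>
      simp only [Fin.castSucc_zero, Fin.insertNth_zero', Fin.cons_zero, Fin.update_cons_zero]
      rw [lprod_ofFn_cons]
      cases n with
      | zero => simp [lprod]
      | succ n => rw [lprod_ofFn_cons, lprod_ofFn_cons, mul_assoc]
    | succ j =>
      cases n with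
      | zero => exact j.elim0
      | succ n =>
        rw [Fin.castSucc_succ, insertNth_succ_cons, lprod_ofFn_cons, ih, Fin.cons_succ,
          ← Fin.cons_update, lprod_ofFn_cons]

theorem lprod_insertNth_succ [NonUnitalSemiring A] {n : ℕ} (j : Fin n) (u : A)
    (w : Fin n → A) :
    lprod (List.ofFn (Fin.insertNth j.succ u w : Fin (n + 1) → A)) =
      lprod (List.ofFn (Function.update w j (w j * u))) := by
  induction n with
  | zero => exact j.elim0
  | succ n ih =>
    induction w using Fin.consCases with
    | _ a w =>
    rw [insertNth_succ_cons, lprod_ofFn_cons]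
    cases j using Fin.cases with
    | zero =>
      simp only [Fin.insertNth_zero', Fin.cons_zero, Fin.update_cons_zero]
      cases n with
      | zero => simp [lprod]
      | succ n => rw [lprod_ofFn_cons, lprod_ofFn_cons, mul_assoc]
    | succ j =>
      cases n with
      | zero => exact j.elim0
      | succ n => rw [ih, Fin.cons_succ, ← Fin.cons_update, lprod_ofFn_cons]

theorem lprod_insertNth_last [NonUnitalSemiring A] {n : ℕ} (u : A) (w : Fin (n + 1) → A) :
    lprod (List.ofFn (Fin.insertNth (Fin.last (n + 1)) u w : Fin (n + 2) → A)) =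
      lprod (List.ofFn w) * u := by
  induction n with
  | zero =>
    rw [← Fin.succ_last, lprod_insertNth_succ]
    simp [lprod]
  | succ n ih =>
    induction w using Fin.consCases with
    | _ a w => rw [← Fin.succ_last, insertNth_succ_cons, lprod_ofFn_cons, ih, lprod_ofFn_cons,
        mul_assoc]

/-- The permutation sending `j` to `0` and restricting to `τ` on the complements. -/
def insertPerm {n : ℕ} (j : Fin (n + 1)) (τ : Equiv.Perm (Fin n)) : Equiv.Perm (Fin (n + 1)) :=
  ((finSuccEquiv' j).trans (Equiv.optionCongr τ)).trans (finSuccEquiv' 0).symm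

theorem insertPerm_self {n : ℕ} (j : Fin (n + 1)) (τ : Equiv.Perm (Fin n)) :
    insertPerm j τ j = 0 := by
  simp [insertPerm]

theorem insertPerm_succAbove {n : ℕ} (j : Fin (n + 1)) (τ : Equiv.Perm (Fin n)) (i : Fin n) :
    insertPerm j τ (j.succAbove i) = (τ i).succ := by
  simp [insertPerm]

theorem insertPerm_bijective (n : ℕ) :
    Function.Bijective fun q : Fin (n + 1) × Equiv.Perm (Fin n) ↦ insertPerm q.1 q.2 := by
  rw [Fintype.bijective_iff_injective_and_card]
  constructor
  · rintro ⟨j, τ⟩ ⟨j', τ'⟩ h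
    simp only at h
    obtain rfl : j = j' := by
      apply (insertPerm j τ).injective
      rw [insertPerm_self, h, insertPerm_self]
    congr 1
    ext i : 1
    apply Fin.succ_injective
    rw [← insertPerm_succAbove j τ, h, insertPerm_succAbove]
  · simp [Fintype.card_perm, Nat.factorial_succ]

theorem cons_comp_insertPerm {n : ℕ} (u : A) (y : Fin n → A) (j : Fin (n + 1))
    (τ : Equiv.Perm (Fin n)) :
    (fun i ↦ (Fin.cons u y : Fin (n + 1) → A) (insertPerm j τ i)) =
      Fin.insertNth j u (fun i ↦ y (τ i)) := by
  ext i
  induction i using Fin.succAboveCases j with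
  | x => simp [insertPerm_self]
  | p i => simp [insertPerm_succAbove]

theorem Ssym_cons [NonUnitalSemiring A] {n : ℕ} (u : A) (y : Fin n → A) :
    Ssym (n + 1) (Fin.cons u y : Fin (n + 1) → A) =
      ∑ j : Fin (n + 1), ∑ τ : Equiv.Perm (Fin n),
        lprod (List.ofFn (Fin.insertNth j u (fun i ↦ y (τ i)) : Fin (n + 1) → A)) := by
  rw [Ssym, ← (insertPerm_bijective n).sum_comp, Fintype.sum_prod_type]
  simp only [cons_comp_insertPerm]

theorem sum_update_comp_perm [NonUnitalSemiring A] {n : ℕ} (y z : Fin n → A) :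
    ∑ j : Fin n, ∑ τ : Equiv.Perm (Fin n),
        lprod (List.ofFn (Function.update (fun i ↦ y (τ i)) j (z (τ j)))) =
      ∑ i : Fin n, Ssym n (Function.update y i (z i)) := by
  simp only [Ssym]
  rw [Finset.sum_comm, Finset.sum_comm (γ := Fin n)]
  refine Finset.sum_congr rfl fun τ _ ↦ ?_
  refine (Finset.sum_congr rfl fun j _ ↦ ?_).trans
    (Equiv.sum_comp τ fun i ↦ lprod (List.ofFn fun l ↦ Function.update y i (z i) (τ l)))
  congr 2
  ext i
  simp [Function.update_apply]

theorem Ssym_cons_eq_mul_right [NonUnitalSemiring A] {n : ℕ} (u : A) (y : Fin (n + 1) → A) :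
    Ssym (n + 2) (Fin.cons u y : Fin (n + 2) → A) =
      ∑ i, Ssym (n + 1) (Function.update y i (u * y i)) + Ssym (n + 1) y * u := by
  rw [Ssym_cons, Fin.sum_univ_castSucc]
  simp only [lprod_insertNth_castSucc, lprod_insertNth_last]
  rw [sum_update_comp_perm y (fun i ↦ u * y i), ← Finset.sum_mul, Ssym]

theorem Ssym_cons_eq_mul_left [NonUnitalSemiring A] {n : ℕ} (u : A) (y : Fin (n + 1) → A) :
    Ssym (n + 2) (Fin.cons u y : Fin (n + 2) → A) =
      u * Ssym (n + 1) y + ∑ i, Ssym (n + 1) (Function.update y i (y i * u)) := by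
  rw [Ssym_cons, Fin.sum_univ_succ]
  simp only [lprod_insertNth_succ, Fin.insertNth_zero', lprod_ofFn_cons]
  rw [sum_update_comp_perm y (fun i ↦ y i * u), ← Finset.mul_sum, Ssym]

theorem Ssym_comp_perm [NonUnitalSemiring A] {n : ℕ} (y : Fin n → A) (π : Equiv.Perm (Fin n)) :
    Ssym n (fun i ↦ y (π i)) = Ssym n y :=
  Fintype.sum_equiv (Equiv.mulLeft π) _ _ fun _ ↦ rfl

theorem Ssym_cons_cons_comm [NonUnitalSemiring A] {n : ℕ} (a b : A) (y : Fin n → A) :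
    Ssym (n + 2) (Fin.cons a (Fin.cons b y : Fin (n + 1) → A) : Fin (n + 2) → A) =
      Ssym (n + 2) (Fin.cons b (Fin.cons a y : Fin (n + 1) → A) : Fin (n + 2) → A) := by
  rw [← Ssym_comp_perm _ (Equiv.swap 0 1)]
  congr 1
  ext i
  cases i using Fin.cases with
  | zero => simp
  | succ i =>
    cases i using Fin.cases with
    | zero => simp
    | succ i =>
      rw [Equiv.swap_apply_of_ne_of_ne (Fin.succ_ne_zero _)]
      · simp
      · exact fun h ↦ Fin.succ_ne_zero i (Fin.succ_injective _ h)

theorem map_Ssym [NonUnitalSemiring A] {B F : Type*} [NonUnitalSemiring B] [FunLike F A B]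
    [NonUnitalRingHomClass F A B] (f : F) {d : ℕ} (y : Fin d → A) :
    f (Ssym d y) = Ssym d (fun i ↦ f (y i)) := by
  simp [Ssym, map_lprod, List.map_ofFn, Function.comp_def]

end Words

section SymSpan

variable {k A : Type*} [Field k] [NonUnitalRing A] [Module k A]

variable (k A) in
/-- The span of all values of the symmetrization in `d` arguments. -/
def symSpan (d : ℕ) : Submodule k A :=
  Submodule.span k (Set.range (Ssym d : (Fin d → A) → A))

theorem Ssym_mem_symSpan {d : ℕ} (y : Fin d → A) : Ssym d y ∈ symSpan k A d :=
  Submodule.subset_span ⟨y, rfl⟩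

theorem Ssym_mul_sub_mem_symSpan {n : ℕ} (a b : A) (y : Fin n → A) :
    Ssym (n + 1) (Fin.cons a y : Fin (n + 1) → A) * b -
      Ssym (n + 1) (Fin.cons b y : Fin (n + 1) → A) * a ∈ symSpan k A (n + 1) := by
  have h := (Ssym_cons_eq_mul_right b (Fin.cons a y : Fin (n + 1) → A)).symm.trans
    ((Ssym_cons_cons_comm b a y).trans
      (Ssym_cons_eq_mul_right a (Fin.cons b y : Fin (n + 1) → A)))
  rw [add_comm] at h
  rw [sub_eq_sub_iff_add_eq_add.2 h]
  exact sub_mem (sum_mem fun i _ ↦ Ssym_mem_symSpan _) (sum_mem fun i _ ↦ Ssym_mem_symSpan _)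

end SymSpan

section Powers

variable {k A : Type*} [Field k] [NonUnitalRing A] [Module k A] [IsScalarTower k A A]
  [SMulCommClass k A A]

/-- The product of two subspaces of a non-unital algebra. -/
def mulSub (U V : Submodule k A) : Submodule k A :=
  Submodule.map₂ (LinearMap.mul k A) U V

theorem mul_mem_mulSub {U V : Submodule k A} {u v : A} (hu : u ∈ U) (hv : v ∈ V) :
    u * v ∈ mulSub U V :=
  Submodule.apply_mem_map₂ (LinearMap.mul k A) hu hv

theorem mulSub_le {U V W : Submodule k A} :
    mulSub U V ≤ W ↔ ∀ u ∈ U, ∀ v ∈ V, u * v ∈ W :=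
  Submodule.map₂_le

theorem mulSub_mono {U U' V V' : Submodule k A} (hU : U ≤ U') (hV : V ≤ V') :
    mulSub U V ≤ mulSub U' V' :=
  Submodule.map₂_le_map₂ hU hV

theorem mulSub_assoc (U V W : Submodule k A) :
    mulSub (mulSub U V) W = mulSub U (mulSub V W) := by
  apply le_antisymm
  · rw [mulSub_le]
    intro x hx w hw
    have : mulSub U V ≤ (mulSub U (mulSub V W)).comap ((LinearMap.mul k A).flip w) := by
      rw [mulSub_le]
      intro u hu v hv
      simpa [mul_assoc] using mul_mem_mulSub hu (mul_mem_mulSub hv hw)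
    exact this hx
  · rw [mulSub_le]
    intro u hu x hx
    have : mulSub V W ≤ (mulSub (mulSub U V) W).comap (LinearMap.mul k A u) := by
      rw [mulSub_le]
      intro v hv w hw
      simpa [mul_assoc] using mul_mem_mulSub (mul_mem_mulSub hu hv) hw
    exact this hx

theorem commutator_mem_mulSub {U V : Submodule k A} (hU : ∀ u ∈ U, ∀ a, u * a - a * u ∈ U)
    (hV : ∀ v ∈ V, ∀ a, v * a - a * v ∈ V) :
    ∀ x ∈ mulSub U V, ∀ a, x * a - a * x ∈ mulSub U V := by
  intro x hx a
  have : mulSub U V ≤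
      (mulSub U V).comap ((LinearMap.mul k A).flip a - LinearMap.mul k A a) := by
    rw [mulSub_le]
    intro u hu v hv
    have := add_mem (mul_mem_mulSub hu (hV v hv a)) (mul_mem_mulSub (hU u hu a) hv)
    simpa [mul_sub, sub_mul, mul_assoc] using this
  exact this hx

theorem commutator_mem_symSpan {n : ℕ} :
    ∀ x ∈ symSpan k A (n + 1), ∀ a, x * a - a * x ∈ symSpan k A (n + 1) := by
  intro x hx a
  have : symSpan k A (n + 1) ≤
      (symSpan k A (n + 1)).comap ((LinearMap.mul k A).flip a - LinearMap.mul k A a) := by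
    refine Submodule.span_le.2 ?_
    rintro _ ⟨y, rfl⟩
    have h := (Ssym_cons_eq_mul_right a y).symm.trans (Ssym_cons_eq_mul_left a y)
    have h' : Ssym (n + 1) y * a - a * Ssym (n + 1) y =
        ∑ i, Ssym (n + 1) (Function.update y i (y i * a)) -
          ∑ i, Ssym (n + 1) (Function.update y i (a * y i)) := by
      rw [sub_eq_sub_iff_add_eq_add, add_comm, h, add_comm]
    simp only [Submodule.comap_coe, Set.mem_preimage, LinearMap.sub_apply, LinearMap.flip_apply,
      LinearMap.mul_apply', SetLike.mem_coe, h']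
    exact sub_mem (sum_mem fun i _ ↦ Ssym_mem_symSpan _) (sum_mem fun i _ ↦ Ssym_mem_symSpan _)
  exact this hx

theorem exists_leftIdeal_mulSub_symSpan {n : ℕ} (N : Submodule k A)
    (hN : ∀ v ∈ N, ∀ a, v * a - a * v ∈ N) :
    ∃ K : Submodule k A, (∀ a, ∀ x ∈ K, a * x ∈ K) ∧
      mulSub (symSpan k A (n + 1)) N ≤ symSpan k A (n + 1) ⊔ K ∧
      K ≤ symSpan k A (n + 1) ⊔ mulSub (symSpan k A (n + 1)) N := by
  set M := symSpan k A (n + 1) with hM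
  set V := M ⊔ mulSub M N with hV
  have hVcomm : ∀ x ∈ V, ∀ a, x * a - a * x ∈ V := by
    intro x hx a
    obtain ⟨y, hy, z, hz, rfl⟩ := Submodule.mem_sup.1 hx
    rw [add_mul, mul_add, add_sub_add_comm]
    exact add_mem (Submodule.mem_sup_left (commutator_mem_symSpan y hy a))
      (Submodule.mem_sup_right (commutator_mem_mulSub commutator_mem_symSpan hN z hz a))
  have hmem : ∀ q ∈ N, ∀ (y : Fin n → A) (b : A),
      Ssym (n + 1) (Fin.cons q y : Fin (n + 1) → A) * b ∈ V := by
    intro q hq y b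
    rw [← sub_add_cancel (Ssym (n + 1) (Fin.cons q y : Fin (n + 1) → A) * b)
      (Ssym (n + 1) (Fin.cons b y : Fin (n + 1) → A) * q)]
    exact add_mem (Submodule.mem_sup_left (Ssym_mul_sub_mem_symSpan _ _ _))
      (Submodule.mem_sup_right (mul_mem_mulSub (Ssym_mem_symSpan _) hq))
  let K : Submodule k A := V ⊓ ⨅ a : A, V.comap (LinearMap.mul k A a)
  have hK : ∀ x, x ∈ K ↔ x ∈ V ∧ ∀ a, a * x ∈ V := by
    simp [K, Submodule.mem_iInf]
  refine ⟨K, ?_, ?_, inf_le_left⟩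
  · intro a x hx
    rw [hK] at hx ⊢
    exact ⟨hx.2 a, fun b ↦ by rw [← mul_assoc]; exact hx.2 _⟩
  · have key : ∀ q ∈ N, M ≤ (M ⊔ K).comap ((LinearMap.mul k A).flip q) := by
      intro q hq
      refine Submodule.span_le.2 ?_
      rintro _ ⟨y, rfl⟩
      induction y using Fin.consCases with
      | _ b y =>
      simp only [Submodule.comap_coe, Set.mem_preimage, LinearMap.flip_apply,
        LinearMap.mul_apply', SetLike.mem_coe]
      rw [← sub_add_cancel (Ssym (n + 1) (Fin.cons b y : Fin (n + 1) → A) * q)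
        (Ssym (n + 1) (Fin.cons q y : Fin (n + 1) → A) * b)]
      refine add_mem (Submodule.mem_sup_left (Ssym_mul_sub_mem_symSpan _ _ _))
        (Submodule.mem_sup_right ((hK _).2 ⟨hmem q hq y b, fun a ↦ ?_⟩))
      rw [← sub_sub_cancel (Ssym (n + 1) (Fin.cons q y : Fin (n + 1) → A) * b * a)
        (a * (Ssym (n + 1) (Fin.cons q y : Fin (n + 1) → A) * b))]
      refine sub_mem ?_ (hVcomm _ (hmem q hq y b) a)
      rw [mul_assoc]
      exact hmem q hq y _
    rw [mulSub_le]
    exact fun u hu q hq ↦ key q hq hu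

variable (k A) in
/-- The power with exponent `m + 1` of `symSpan k A d`. -/
def symPow (d : ℕ) : ℕ → Submodule k A
  | 0 => symSpan k A d
  | m + 1 => mulSub (symPow d m) (symSpan k A d)

theorem mulSub_symPow (d a b : ℕ) :
    mulSub (symPow k A d a) (symPow k A d b) = symPow k A d (a + b + 1) := by
  induction b with
  | zero => rfl
  | succ b ih => rw [symPow, ← mulSub_assoc, ih]; rfl

theorem commutator_mem_symPow (n m : ℕ) :
    ∀ x ∈ symPow k A (n + 1) m, ∀ a, x * a - a * x ∈ symPow k A (n + 1) m := by
  induction m with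
  | zero => exact commutator_mem_symSpan
  | succ m ih => exact commutator_mem_mulSub ih commutator_mem_symSpan

theorem exists_leftIdeal_symPow (n r a : ℕ) (hr : 1 ≤ r) :
    ∃ K : Submodule k A, (∀ a, ∀ x ∈ K, a * x ∈ K) ∧
      symPow k A (n + 1) (a + r) ≤ symPow k A (n + 1) a ⊔ K ∧
      K ≤ symPow k A (n + 1) a ⊔ symPow k A (n + 1) (a + r) := by
  obtain ⟨s, rfl⟩ := Nat.exists_eq_add_of_le' hr
  induction a with
  | zero =>
    have h := exists_leftIdeal_mulSub_symSpan (n := n) (symPow k A (n + 1) s)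
      (commutator_mem_symPow n s)
    have e : mulSub (symSpan k A (n + 1)) (symPow k A (n + 1) s) =
        symPow k A (n + 1) (0 + (s + 1)) := mulSub_symPow (n + 1) 0 s
    rw [e] at h
    exact h
  | succ a ih =>
    obtain ⟨K, hK, h₁, h₂⟩ := ih
    have e : symPow k A (n + 1) (a + 1 + (s + 1)) =
        mulSub (symPow k A (n + 1) (a + (s + 1))) (symSpan k A (n + 1)) := by
      rw [show a + 1 + (s + 1) = a + (s + 1) + 1 by ring]; rfl
    refine ⟨mulSub K (symSpan k A (n + 1)), fun b x hx ↦ ?_, ?_, ?_⟩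
    · have : mulSub K (symSpan k A (n + 1)) ≤
          (mulSub K (symSpan k A (n + 1))).comap (LinearMap.mul k A b) := by
        rw [mulSub_le]
        intro u hu v hv
        simpa [mul_assoc] using mul_mem_mulSub (hK b u hu) hv
      exact this hx
    · rw [e, symPow, mulSub, mulSub, mulSub, ← Submodule.map₂_sup_left]
      exact mulSub_mono h₁ le_rfl
    · rw [e, symPow, mulSub, mulSub, mulSub, ← Submodule.map₂_sup_left]
      exact mulSub_mono h₂ le_rfl

theorem symPow_add_le (n : ℕ) {a r c : ℕ} (hr : 1 ≤ r) (hc : a ≤ c) :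
    symPow k A (n + 1) (c + r) ≤
      symPow k A (n + 1) c ⊔ (symPow k A (n + 1) a ⊔ symPow k A (n + 1) (a + r)) := by
  obtain rfl | hlt := hc.eq_or_lt
  · exact le_sup_of_le_right le_sup_right
  obtain ⟨e, rfl⟩ := Nat.exists_eq_add_of_lt hlt
  obtain ⟨K, hK, h₁, h₂⟩ := exists_leftIdeal_symPow (k := k) (A := A) n r a hr
  rw [show a + e + 1 + r = e + (a + r) + 1 by ring, show a + e + 1 = e + a + 1 by ring,
    ← mulSub_symPow, ← mulSub_symPow (n + 1) e a]
  refine (mulSub_mono le_rfl h₁).trans ?_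
  rw [mulSub, Submodule.map₂_sup_right]
  refine sup_le_sup le_rfl (le_trans ?_ h₂)
  exact mulSub_le.2 fun u _ x hx ↦ hK u x hx

end Powers

section FreeAlgebra

variable {k : Type*} [Field k]

/-- The substitution endomorphism sending the variable `x_i` to `y i`. -/
noncomputable def substHom (y : ℕ → FA k) : FA k →ₙₐ[k] FA k :=
  MonoidAlgebra.liftMagma k (FreeSemigroup.lift y)

theorem substHom_Xg (y : ℕ → FA k) (i : ℕ) : substHom y (Xg k i) = y i := by
  simp [substHom, Xg]

theorem subset_TSpan (S : Set (FA k)) : S ⊆ TSpan k S :=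
  fun s hs ↦ Submodule.subset_span ⟨NonUnitalAlgHom.id k (FA k), s, hs, rfl⟩

theorem TSpan_le {S : Set (FA k)} {V : Submodule k (FA k)} (hV : IsTSpace k V) :
    TSpan k S ≤ V ↔ S ⊆ V := by
  refine ⟨fun h ↦ (subset_TSpan S).trans h, fun h ↦ Submodule.span_le.2 ?_⟩
  rintro _ ⟨φ, s, hs, rfl⟩
  exact hV φ s (h hs)

theorem isTSpace_TSpan (S : Set (FA k)) : IsTSpace k (TSpan k S) := by
  intro φ v hv
  induction hv using Submodule.span_induction with
  | mem x hx =>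
    obtain ⟨ψ, s, hs, rfl⟩ := hx
    exact Submodule.subset_span ⟨φ.comp ψ, s, hs, rfl⟩
  | zero => rw [map_zero]; exact zero_mem _
  | add x y _ _ hx hy => rw [map_add]; exact add_mem hx hy
  | smul c x _ hx => rw [map_smul]; exact Submodule.smul_mem _ c hx

theorem isTSpace_mulSub {U V : Submodule k (FA k)} (hU : IsTSpace k U) (hV : IsTSpace k V) :
    IsTSpace k (mulSub U V) := by
  intro φ x hx
  have : mulSub U V ≤ (mulSub U V).comap (φ : FA k →ₗ[k] FA k) := by
    rw [mulSub_le]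
    intro u hu v hv
    simpa using mul_mem_mulSub (hU φ u hu) (hV φ v hv)
  exact this hx

theorem TSpan_mulSet {U V : Submodule k (FA k)} (hU : IsTSpace k U) (hV : IsTSpace k V) :
    TSpan k (mulSet U V) = mulSub U V := by
  apply le_antisymm
  · rw [TSpan_le (isTSpace_mulSub hU hV)]
    rintro _ ⟨u, hu, v, hv, rfl⟩
    exact mul_mem_mulSub hu hv
  · rw [mulSub_le]
    exact fun u hu v hv ↦ subset_TSpan _ ⟨u, hu, v, hv, rfl⟩

theorem Sn_one (d : ℕ) : Sn k d 1 = symSpan k (FA k) d := by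
  rw [Sn]
  apply le_antisymm
  · refine Submodule.span_le.2 ?_
    rintro _ ⟨φ, _, rfl, rfl⟩
    rw [map_Ssym]
    exact Ssym_mem_symSpan _
  · refine Submodule.span_le.2 ?_
    rintro _ ⟨y, rfl⟩
    refine Submodule.subset_span
      ⟨substHom fun i ↦ if h : i < d then y ⟨i, h⟩ else 0, _, rfl, ?_⟩
    simp [map_Ssym, substHom_Xg]

theorem isTSpace_Sn (d : ℕ) : ∀ m, IsTSpace k (Sn k d m)
  | 0 => fun φ v hv ↦ by
    have : v = 0 := by simpa [Sn] using hv
    simp [this]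
  | 1 => by rw [Sn]; exact isTSpace_TSpan _
  | _ + 2 => by rw [Sn]; exact isTSpace_TSpan _

theorem Sn_succ (d m : ℕ) : Sn k d (m + 1) = symPow k (FA k) d m := by
  induction m with
  | zero => exact Sn_one d
  | succ m ih =>
    rw [Sn, TSpan_mulSet (isTSpace_Sn d _) (isTSpace_Sn d _), Sn_one, ih]
    rfl

/-- The product of `m + 1` symmetrizations in the rows of an array. -/
def prodSsym {A : Type*} [NonUnitalSemiring A] (d : ℕ) : ℕ → (ℕ → Fin d → A) → A
  | 0, y => Ssym d (y 0)
  | m + 1, y => prodSsym d m y * Ssym d (y (m + 1))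

theorem prodSsym_congr {A : Type*} [NonUnitalSemiring A] {d m : ℕ} {y z : ℕ → Fin d → A}
    (h : ∀ t ≤ m, y t = z t) : prodSsym d m y = prodSsym d m z := by
  induction m with
  | zero => simp [prodSsym, h]
  | succ m ih => rw [prodSsym, prodSsym, ih fun t ht ↦ h t (by omega), h _ le_rfl]

theorem map_prodSsym {A B F : Type*} [NonUnitalSemiring A] [NonUnitalSemiring B] [FunLike F A B]
    [NonUnitalRingHomClass F A B] (f : F) (d m : ℕ) (y : ℕ → Fin d → A) :
    f (prodSsym d m y) = prodSsym d m (fun t i ↦ f (y t i)) := by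
  induction m with
  | zero => simp [prodSsym, map_Ssym]
  | succ m ih => simp [prodSsym, map_Ssym, ih]

theorem symPow_eq_span_range {A : Type*} [NonUnitalRing A] [Module k A] [IsScalarTower k A A]
    [SMulCommClass k A A] (d m : ℕ) :
    symPow k A d m =
      Submodule.span k (Set.range (prodSsym d m : (ℕ → Fin d → A) → A)) := by
  induction m with
  | zero =>
    rw [symPow, symSpan]
    congr 1
    ext x
    constructor
    · rintro ⟨y, rfl⟩
      exact ⟨fun _ ↦ y, rfl⟩
    · rintro ⟨y, rfl⟩
      exact ⟨y 0, rfl⟩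
  | succ m ih =>
    rw [symPow, ih, symSpan, mulSub, Submodule.map₂_span_span]
    congr 1
    ext x
    constructor
    · rintro ⟨_, ⟨y, rfl⟩, _, ⟨z, rfl⟩, rfl⟩
      refine ⟨fun t ↦ if t ≤ m then y t else z, ?_⟩
      rw [prodSsym, prodSsym_congr (z := y) (by simp +contextual)]
      simp
    · rintro ⟨y, rfl⟩
      exact ⟨_, ⟨y, rfl⟩, _, ⟨y (m + 1), rfl⟩, rfl⟩

variable (k) in
/-- A single generator of the T-space `Sn k d (m + 1)`. -/
noncomputable def genSn (d m : ℕ) : FA k :=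
  prodSsym d m fun t i ↦ Xg k (Nat.pair t i)

theorem TSpan_genSn (d m : ℕ) : TSpan k {genSn k d m} = Sn k d (m + 1) := by
  rw [Sn_succ, symPow_eq_span_range]
  apply le_antisymm
  · refine Submodule.span_le.2 ?_
    rintro _ ⟨φ, _, rfl, rfl⟩
    rw [genSn, map_prodSsym]
    exact Submodule.subset_span ⟨_, rfl⟩
  · refine Submodule.span_le.2 ?_
    rintro _ ⟨y, rfl⟩
    refine Submodule.subset_span ⟨substHom fun v ↦
      if h : v.unpair.2 < d then y v.unpair.1 ⟨v.unpair.2, h⟩ else 0, _, rfl, ?_⟩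
    simp [genSn, map_prodSsym, substHom_Xg]

theorem Sn_add_le {d : ℕ} (hd : 1 ≤ d) {a r c : ℕ} (ha : 1 ≤ a) (hr : 1 ≤ r) (hc : a ≤ c) :
    Sn k d (c + r) ≤ Sn k d c ⊔ (Sn k d a ⊔ Sn k d (a + r)) := by
  obtain ⟨n, rfl⟩ := Nat.exists_eq_add_of_le' hd
  obtain ⟨a, rfl⟩ := Nat.exists_eq_add_of_le' ha
  obtain ⟨c, rfl⟩ := Nat.exists_eq_add_of_le' (ha.trans hc)
  rw [Nat.add_right_comm, Nat.add_right_comm a, Sn_succ, Sn_succ, Sn_succ, Sn_succ]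
  exact symPow_add_le n hr (by omega)

theorem Sn_add_mul_le {d : ℕ} (hd : 1 ≤ d) {a r c : ℕ} (ha : 1 ≤ a) (hr : 1 ≤ r) (hc : a ≤ c)
    (t : ℕ) : Sn k d (c + t * r) ≤ Sn k d c ⊔ (Sn k d a ⊔ Sn k d (a + r)) := by
  induction t with
  | zero => simp
  | succ t ih =>
    rw [add_mul, one_mul, ← add_assoc]
    exact (Sn_add_le hd ha hr (hc.trans (Nat.le_add_right _ _))).trans (sup_le ih le_sup_right)

end FreeAlgebra

/-- For any strictly increasing sequence `i_1 < i_2 < ⋯` of positive integers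
(`i j` plays the role of `i_{j+1}`), the T-space generated by `⋃_j S_{i_j}^{(d)}`
has a T-space basis of size at most `i_2 - i_1 + 1`. -/
theorem R_infty_finitely_based (k : Type*) [Field k] (p : ℕ) (hp : p.Prime) [CharP k p]
    (d : ℕ) (hd : 1 ≤ d) (i : ℕ → ℕ) (hmono : StrictMono i) (hpos : 1 ≤ i 0) :
    ∃ G : Finset (FA k), G.card ≤ i 1 - i 0 + 1 ∧
      TSpan k ↑G = TSpan k (⋃ j : ℕ, (Sn k d (i j) : Set (FA k))) := by
  classical
  obtain ⟨r, hr⟩ := Nat.exists_eq_add_of_lt (hmono Nat.zero_lt_one)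
  have hrep : ∀ ρ : ℕ, ∃ j₀, ∀ j, i j % (r + 1) = ρ → j₀ ≤ j ∧ i j₀ % (r + 1) = ρ := by
    intro ρ
    by_cases h : ∃ j, i j % (r + 1) = ρ
    · exact ⟨Nat.find h, fun j hj ↦ ⟨Nat.find_min' h hj, Nat.find_spec h⟩⟩
    · exact ⟨0, fun j hj ↦ (h ⟨j, hj⟩).elim⟩
  choose rep hrep using hrep
  have hi : ∀ j, 1 ≤ i j := fun j ↦ hpos.trans (hmono.monotone j.zero_le)
  let g : ℕ → FA k := fun j ↦ genSn k d (i j - 1)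
  have hg : ∀ j, TSpan k {g j} = Sn k d (i j) := fun j ↦ by
    rw [TSpan_genSn, Nat.sub_add_cancel (hi j)]
  let G : Finset (FA k) := insert (g 1) ((Finset.range (r + 1)).image fun ρ ↦ g (rep ρ))
  refine ⟨G, ?_, ?_⟩
  · refine (Finset.card_insert_le _ _).trans ?_
    have := Finset.card_image_le (s := Finset.range (r + 1)) (f := fun ρ ↦ g (rep ρ))
    rw [Finset.card_range] at this
    omega
  apply le_antisymm
  · rw [TSpan_le (isTSpace_TSpan _)]
    have hmem : ∀ j, g j ∈ TSpan k (⋃ j : ℕ, (Sn k d (i j) : Set (FA k))) := fun j ↦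
      subset_TSpan _ (Set.mem_iUnion.2 ⟨j, by rw [← hg j]; exact subset_TSpan _ rfl⟩)
    intro x hx
    obtain rfl | hx := Finset.mem_insert.1 (Finset.mem_coe.1 hx)
    · exact hmem 1
    · obtain ⟨ρ, _, rfl⟩ := Finset.mem_image.1 hx
      exact hmem _
  · have hsub : ∀ j, g j ∈ G → Sn k d (i j) ≤ TSpan k (G : Set (FA k)) := fun j hj ↦ by
      rw [← hg j, TSpan_le (isTSpace_TSpan _), Set.singleton_subset_iff]
      exact subset_TSpan _ hj
    have hclass : ∀ j, Sn k d (i (rep (i j % (r + 1)))) ≤ TSpan k (G : Set (FA k)) := fun j ↦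
      hsub _ (Finset.mem_insert_of_mem (Finset.mem_image_of_mem (fun ρ ↦ g (rep ρ))
        (Finset.mem_range.2 (Nat.mod_lt _ r.succ_pos))))
    have h0 : Sn k d (i 0) ≤ TSpan k (G : Set (FA k)) := by
      have h := hclass 0
      rwa [Nat.le_zero.1 (hrep _ 0 rfl).1] at h
    have h1 : Sn k d (i 0 + (r + 1)) ≤ TSpan k (G : Set (FA k)) := by
      rw [← add_assoc, ← hr]
      exact hsub 1 (Finset.mem_insert_self _ _)
    rw [TSpan_le (isTSpace_TSpan _)]
    refine Set.iUnion_subset fun j ↦ ?_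
    obtain ⟨hle, hmod⟩ := hrep _ j rfl
    obtain ⟨t, ht⟩ := (Nat.modEq_iff_dvd' (hmono.monotone hle)).1 hmod
    have hj : i j = i (rep (i j % (r + 1))) + t * (r + 1) := by
      have := hmono.monotone hle
      rw [mul_comm, ← ht]
      omega
    rw [hj]
    exact (Sn_add_mul_le hd hpos r.succ_pos (hmono.monotone (Nat.zero_le _)) t).trans
      (sup_le (hclass j) (sup_le h0 h1))
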